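/- Let K be an algebraically closed field of characteristic zero, n ≥ 3, and λ ∈ K with λ ≠ -1. Then every trace zero matrix D ∈ M_n(K) can be written as D = [A,B][A,C] + λ[A,C][A,B] for suitable matrices A, B, C ∈ M_n(K). -/

import Mathlib

open Matrix

/-- The matrix with first row `(d, r)`, zeros below `d`, and lower right block `T`. -/
def bordered {K : Type*} [Zero K] {n : ℕ} (d : K) (r : Fin n → K) (T : Matrix (Fin n) (Fin n) K) :
    Matrix (Fin (n + 1)) (Fin (n + 1)) K :=
  Matrix.of (Fin.cons (Fin.cons d r) fun i => Fin.cons 0 (T i))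

section Bordered

variable {K : Type*} {n : ℕ}

@[simp] lemma bordered_zero_zero [Zero K] (d : K) (r : Fin n → K) (T : Matrix (Fin n) (Fin n) K) :
    bordered d r T 0 0 = d := rfl

@[simp] lemma bordered_zero_succ [Zero K] (d : K) (r : Fin n → K) (T : Matrix (Fin n) (Fin n) K)
    (j : Fin n) : bordered d r T 0 j.succ = r j := rfl

@[simp] lemma bordered_succ_zero [Zero K] (d : K) (r : Fin n → K) (T : Matrix (Fin n) (Fin n) K)
    (i : Fin n) : bordered d r T i.succ 0 = 0 := rfl

@[simp] lemma bordered_succ_succ [Zero K] (d : K) (r : Fin n → K) (T : Matrix (Fin n) (Fin n) K)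
    (i j : Fin n) : bordered d r T i.succ j.succ = T i j := rfl

lemma eq_bordered [Zero K] (N : Matrix (Fin (n + 1)) (Fin (n + 1)) K)
    (h : ∀ i : Fin n, N i.succ 0 = 0) :
    N = bordered (N 0 0) (fun j => N 0 j.succ) (N.submatrix Fin.succ Fin.succ) := by
  ext i j
  refine Fin.cases ?_ (fun i => ?_) i <;> refine Fin.cases ?_ (fun j => ?_) j <;> simp [h]

lemma bordered_mul [CommRing K] (a b : K) (r s : Fin n → K) (S T : Matrix (Fin n) (Fin n) K) :
    bordered a r S * bordered b s T = bordered (a * b) (a • s + r ᵥ* T) (S * T) := by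
  ext i j
  refine Fin.cases ?_ (fun i => ?_) i <;> refine Fin.cases ?_ (fun j => ?_) j <;>
    simp [Matrix.mul_apply, Fin.sum_univ_succ, Matrix.vecMul, dotProduct]

lemma bordered_one [CommRing K] : bordered 1 0 (1 : Matrix (Fin n) (Fin n) K) = 1 := by
  ext i j
  refine Fin.cases ?_ (fun i => ?_) i <;> refine Fin.cases ?_ (fun j => ?_) j <;>
    simp [Matrix.one_apply, Fin.succ_ne_zero, (Fin.succ_ne_zero _).symm]

lemma isUnit_bordered_one [CommRing K] (z : Fin n → K) {P : Matrix (Fin n) (Fin n) K}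
    (hP : IsUnit P) : IsUnit (bordered 1 z P) := by
  obtain ⟨P, rfl⟩ := hP
  refine IsUnit.of_mul_eq_one (bordered 1 (-(z ᵥ* (P⁻¹ : (Matrix (Fin n) (Fin n) K)ˣ).val))
    (P⁻¹ : (Matrix (Fin n) (Fin n) K)ˣ).val) ?_
  rw [bordered_mul, ← bordered_one]
  simp

lemma isConj_of_isUnit {M : Type*} [Monoid M] {a b c : M} (hc : IsUnit c) (h : c * a = b * c) :
    IsConj a b := by
  obtain ⟨c, rfl⟩ := hc
  exact ⟨c, h⟩

/-- Conjugation inside the lower right block. -/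
lemma isConj_bordered_block [CommRing K] (d : K) (r : Fin n → K) {S T : Matrix (Fin n) (Fin n) K}
    (h : IsConj S T) : ∃ s, IsConj (bordered d r S) (bordered d s T) := by
  obtain ⟨P, hP⟩ := h
  refine ⟨r ᵥ* (P⁻¹ : (Matrix (Fin n) (Fin n) K)ˣ).val,
    isConj_of_isUnit (isUnit_bordered_one 0 P.isUnit) ?_⟩
  rw [bordered_mul, bordered_mul, hP.eq]
  simp

/-- Conjugation changing only the first row. -/
lemma isConj_bordered_row [CommRing K] (d : K) (r z : Fin n → K) (T : Matrix (Fin n) (Fin n) K) :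
    IsConj (bordered d r T) (bordered d (r + z ᵥ* T - d • z) T) := by
  refine isConj_of_isUnit (isUnit_bordered_one z isUnit_one) ?_
  rw [bordered_mul, bordered_mul]
  simp

/-- An invertible matrix with a prescribed nonzero first column. -/
lemma exists_isUnit_first_col [Field K] (v : Fin (n + 1) → K) (hv : v ≠ 0) :
    ∃ Q : Matrix (Fin (n + 1)) (Fin (n + 1)) K, IsUnit Q ∧ ∀ i, Q i 0 = v i := by
  obtain ⟨k, hk⟩ := Function.ne_iff.mp hv
  refine ⟨((1 : Matrix (Fin (n + 1)) (Fin (n + 1)) K).updateCol k v).submatrix id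
    (Equiv.swap 0 k), ?_, fun i => by simp⟩
  rw [Matrix.isUnit_iff_isUnit_det, Matrix.det_permute', ← Matrix.cramer_apply, Matrix.cramer_one]
  simp only [Module.End.one_apply]
  refine IsUnit.mul ?_ (isUnit_iff_ne_zero.mpr hk)
  exact (Units.isUnit (Equiv.Perm.sign (Equiv.swap 0 k))).map (Int.castRingHom K)

lemma exists_isConj_bordered [Field K] [IsAlgClosed K] (D : Matrix (Fin (n + 1)) (Fin (n + 1)) K) :
    ∃ d r S, IsConj D (bordered d r S) := by
  obtain ⟨d, hd⟩ := Module.End.exists_eigenvalue (Matrix.toLin' D)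
  obtain ⟨v, hv⟩ := hd.exists_hasEigenvector
  have hDv : D *ᵥ v = d • v := by simpa using hv.apply_eq_smul
  obtain ⟨Q, ⟨Q, rfl⟩, hQ⟩ := exists_isUnit_first_col v hv.2
  set R : Matrix (Fin (n + 1)) (Fin (n + 1)) K := (Q⁻¹ : (Matrix _ _ K)ˣ).val with hR
  have hcol : Q.val *ᵥ Pi.single 0 1 = v := by
    ext i; simp [hQ]
  have hN : (R * D * Q.val) *ᵥ Pi.single 0 1 = d • Pi.single 0 1 := by
    rw [← Matrix.mulVec_mulVec, hcol, ← Matrix.mulVec_mulVec, hDv, Matrix.mulVec_smul, ← hcol,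
      Matrix.mulVec_mulVec, hR, Units.inv_mul, Matrix.one_mulVec]
  have hconj : IsConj D (R * D * Q.val) :=
    isConj_of_isUnit (c := R) (Units.isUnit _) (by simp [hR, mul_assoc])
  rw [eq_bordered (R * D * Q.val) fun i => by simpa using congrFun hN i.succ] at hconj
  exact ⟨_, _, _, hconj⟩

end Bordered

/-- Every matrix is similar to an upper triangular matrix whose nonzero entries only link equal
diagonal entries. -/
theorem exists_isConj_triangular {K : Type*} [Field K] [IsAlgClosed K] (n : ℕ)
    (D : Matrix (Fin n) (Fin n) K) :
    ∃ T : Matrix (Fin n) (Fin n) K, IsConj D T ∧ (∀ i j, j < i → T i j = 0) ∧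
      ∀ i j, T i j ≠ 0 → T i i = T j j := by
  classical
  induction n with
  | zero => exact ⟨D, IsConj.refl D, fun i => i.elim0, fun i => i.elim0⟩
  | succ n ih =>
    obtain ⟨d, r, S, hS⟩ := exists_isConj_bordered D
    obtain ⟨T, hST, hT, hTd⟩ := ih S
    obtain ⟨s, hs⟩ := isConj_bordered_block d r hST
    -- Solve for a row operation that clears the entries of `s` above diagonal entries `≠ d`.
    let M : Matrix (Fin n) (Fin n) K :=
      Matrix.of fun i j => if T j j = d then (1 : Matrix _ _ K) i j
        else T i j - d * (1 : Matrix _ _ K) i j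
    have hM : M.IsUpperTriangular := by
      intro i j hij
      have hji : j < i := hij
      simp [M, hT i j hji, Matrix.one_apply_ne hji.ne']
    have hMdet : IsUnit M.det := by
      rw [Matrix.det_of_isUpperTriangular hM, isUnit_iff_ne_zero, Finset.prod_ne_zero_iff]
      intro i _
      by_cases h : T i i = d <;> simp [M, h, sub_ne_zero]
    let t : Fin n → K := fun j => if T j j = d then 0 else -s j
    let z := t ᵥ* M⁻¹
    have hz : z ᵥ* M = t := by
      simp [z, Matrix.vecMul_vecMul, Matrix.nonsing_inv_mul _ hMdet]
    refine ⟨_, hS.trans (hs.trans (isConj_bordered_row d s z T)), ?_, ?_⟩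
    · intro i j
      refine Fin.cases ?_ (fun i => ?_) i <;> refine Fin.cases ?_ (fun j => ?_) j <;> intro h
      · simp at h
      · simp at h
      · simp
      · simpa using hT i j (by simpa using h)
    · intro i j
      refine Fin.cases ?_ (fun i => ?_) i <;> refine Fin.cases ?_ (fun j => ?_) j <;> intro h
      · simp
      · by_contra hne
        have hne' : T j j ≠ d := fun h => hne (by simp [h])
        apply h
        have := congrFun hz j
        simp only [Matrix.vecMul, dotProduct, M, t, hne', if_false, Matrix.of_apply, mul_sub,
          Finset.sum_sub_distrib] at this
        simp [Matrix.one_apply] at this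
        simp [Matrix.vecMul, dotProduct]
        linear_combination this
      · simp at h
      · simpa using hTd i j (by simpa using h)

section Commutator

variable {K : Type*} [CommRing K]

/-- The partial sums, going up and to the left, of the diagonals of `z`. -/
def diagSum (z : ℕ → ℕ → K) : ℕ → ℕ → K
  | 0, _ => 0
  | i + 1, 0 => z i 0
  | i + 1, j + 1 => z i (j + 1) + diagSum z i j

lemma diagSum_eq_zero {z : ℕ → ℕ → K} (hz : ∀ i j, j < i → z i j = 0) :
    ∀ i j, j + 1 < i → diagSum z i j = 0
  | 0, _, h => by omega
  | i + 1, 0, h => by simpa [diagSum] using hz i 0 (by omega)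
  | i + 1, j + 1, h => by
    simp [diagSum, hz i (j + 1) (by omega), diagSum_eq_zero hz i j (by omega)]

lemma diagSum_succ_self (z : ℕ → ℕ → K) (i : ℕ) :
    diagSum z (i + 1) i = ∑ k ∈ Finset.range (i + 1), z k k := by
  induction i with
  | zero => simp [diagSum]
  | succ i ih => rw [Finset.sum_range_succ, ← ih, diagSum, add_comm]

/-- The nilpotent Jordan block. -/
def shift (K : Type*) [Zero K] [One K] (n : ℕ) : Matrix (Fin n) (Fin n) K :=
  Matrix.of fun i j => if (i : ℕ) + 1 = j then 1 else 0

lemma shift_mul_apply {n : ℕ} (b : ℕ → ℕ → K) (i j : Fin n) :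
    (shift K n * Matrix.of fun i j : Fin n => b i j) i j =
      if (i : ℕ) + 1 < n then b (i + 1) j else 0 := by
  simp only [Matrix.mul_apply, shift, Matrix.of_apply, ite_mul, one_mul, zero_mul]
  split_ifs with h
  · rw [Finset.sum_eq_single ⟨i + 1, h⟩]
    · simp
    · intro k _ hk
      exact if_neg fun h' => hk (Fin.ext h'.symm)
    · simp
  · exact Finset.sum_eq_zero fun k _ => if_neg (by have := k.2; omega)

lemma mul_shift_apply {n : ℕ} (b : ℕ → ℕ → K) (i j : Fin n) :
    ((Matrix.of fun i j : Fin n => b i j) * shift K n) i j =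
      if (j : ℕ) = 0 then 0 else b i (j - 1) := by
  simp only [Matrix.mul_apply, shift, Matrix.of_apply, mul_ite, mul_one, mul_zero]
  split_ifs with h
  · exact Finset.sum_eq_zero fun k _ => if_neg (by omega)
  · have hj := j.2
    rw [Finset.sum_eq_single ⟨j - 1, by omega⟩]
    · rw [if_pos (by simp only; omega)]
    · intro k _ hk
      exact if_neg fun h' => hk (Fin.ext (by simp only; omega))
    · simp

/-- Upper triangular matrices of trace zero are commutators with the nilpotent Jordan block. -/
theorem exists_shift_commutator {n : ℕ} (Z : Matrix (Fin n) (Fin n) K)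
    (hZ : ∀ i j, j < i → Z i j = 0) (htr : Z.trace = 0) :
    ∃ B, shift K n * B - B * shift K n = Z := by
  let z : ℕ → ℕ → K := fun i j => if h : i < n ∧ j < n then Z ⟨i, h.1⟩ ⟨j, h.2⟩ else 0
  have hz (i j : Fin n) : z i j = Z i j := by simp [z]
  have hz0 : ∀ i j, j < i → z i j = 0 := by
    intro i j hij
    simp only [z]
    split_ifs with h
    · exact hZ _ _ hij
    · rfl
  refine ⟨Matrix.of fun i j => diagSum z i j, ?_⟩
  ext i j
  rw [Matrix.sub_apply, shift_mul_apply, mul_shift_apply]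
  have hi := i.2
  have hj := j.2
  have hstep : (diagSum z (i + 1) j - if (j : ℕ) = 0 then 0 else diagSum z i (j - 1)) = Z i j := by
    rw [← hz]
    rcases (j : ℕ) with _ | k <;> simp [diagSum]
  split_ifs at hstep ⊢ with h₁ h₂ h₂
  · exact hstep
  · exact hstep
  all_goals
    rw [← hstep]
    have hlast : diagSum z (i + 1) j = 0 := by
      by_cases hji : (j : ℕ) < i
      · exact diagSum_eq_zero hz0 _ _ (by omega)
      · have hij : (j : ℕ) = i := by omega
        have hn : (i : ℕ) + 1 = n := by omega
        rw [hij, diagSum_succ_self, hn, Finset.sum_range, ← htr]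
        exact Finset.sum_congr rfl fun k _ => hz k k
    rw [hlast]

end Commutator

section Weights

variable {K : Type*} [Field K]

lemma exists_ne_zero_weights [IsAlgClosed K] [CharZero K] {p q m a b c : K} (hp : p ≠ 0)
    (hq : q ≠ 0) (hm : m ≠ 0) (hpq : p + q ≠ 0) (hqm : q + m ≠ 0) (hpm : p + m ≠ 0) (habc : a + b + c = 0) :
    ∃ u v w : K, u ≠ 0 ∧ v ≠ 0 ∧ w ≠ 0 ∧ p * u + q * v + m * w = 0 ∧
      a * u⁻¹ + b * v⁻¹ + c * w⁻¹ = 0 := by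
  by_cases ha : a = 0
  · refine ⟨-(q + m), p, p, neg_ne_zero.mpr hqm, hp, hp, by ring, ?_⟩
    linear_combination p⁻¹ * habc + (-(q + m))⁻¹ * ha - p⁻¹ * ha
  by_cases hb : b = 0
  · refine ⟨q, -(p + m), q, hq, neg_ne_zero.mpr hpm, hq, by ring, ?_⟩
    linear_combination q⁻¹ * habc + (-(p + m))⁻¹ * hb - q⁻¹ * hb
  by_cases hc : c = 0
  · refine ⟨m, m, -(p + q), hm, hm, neg_ne_zero.mpr hpq, by ring, ?_⟩
    linear_combination m⁻¹ * habc + (-(p + q))⁻¹ * hc - m⁻¹ * hc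
  obtain ⟨u, hu⟩ := exists_quadratic_eq_zero (a := b * p) (b := a * p + b * q - m * c) (c := a * q)
    (mul_ne_zero hb hp) (IsAlgClosed.exists_eq_mul_self _)
  have hu0 : u ≠ 0 := by
    rintro rfl
    exact mul_ne_zero ha hq (by linear_combination hu)
  have hw : u * p + q ≠ 0 := fun h =>
    mul_ne_zero (mul_ne_zero hm hc) hu0 (by linear_combination (a + b * u) * h - hu)
  refine ⟨u, 1, -(u * p + q) / m, hu0, one_ne_zero, div_ne_zero (neg_ne_zero.mpr hw) hm, ?_, ?_⟩
  · field_simp; ring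
  · rw [inv_div, div_neg]
    field_simp
    linear_combination hu

/-- Weights as in `exists_ne_zero_weights` for two parts of sizes `1` and `q` sharing an
eigenvalue, with the first ratio avoiding `-lam`. -/
lemma exists_ne_zero_weights_avoiding [IsAlgClosed K] [CharZero K] {q m : ℕ} (hq : q ≠ 0)
    (hm : m ≠ 0) (lam : K) {a b : K} (hab : (1 + q) * a + m * b = 0) :
    ∃ u w : K, u ≠ 0 ∧ w ≠ 0 ∧ u + lam ≠ 0 ∧ u + q + m * w = 0 ∧
      a * u⁻¹ + q * a + m * b * w⁻¹ = 0 := by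
  have hqK : (q : K) ≠ 0 := Nat.cast_ne_zero.mpr hq
  have hmK : (m : K) ≠ 0 := Nat.cast_ne_zero.mpr hm
  have hq1 : (1 + q : K) ≠ 0 := by exact_mod_cast (by omega : 1 + q ≠ 0)
  set s : K := 1 + q ^ 2 + m * (1 + q) with hs
  have hroot : ∃ u : K, q * (u * u) + s * u + q = 0 ∧ u + lam ≠ 0 := by
    obtain ⟨u, hu⟩ := exists_quadratic_eq_zero (a := (q : K)) (b := s) (c := q)
      hqK (IsAlgClosed.exists_eq_mul_self _)
    have hu0 : u ≠ 0 := by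
      rintro rfl
      exact hqK (by linear_combination hu)
    by_cases h : u + lam = 0
    · refine ⟨u⁻¹, by field_simp; linear_combination hu, fun h' => ?_⟩
      have huu : u * u = 1 := by
        have : u⁻¹ = u := by linear_combination h' - h
        nth_rewrite 1 [← this]
        exact inv_mul_cancel₀ hu0
      rcases mul_self_eq_one_iff.mp huu with rfl | rfl
      · have : ((q + (1 + q ^ 2 + m * (1 + q)) + q : ℕ) : K) = 0 := by
          push_cast; linear_combination hu
        have := Nat.cast_eq_zero.mp this
        omega
      · have : (((q - 1) ^ 2 + m * (1 + q) : ℤ) : K) = 0 := by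
          push_cast; linear_combination -hu
        have := Int.cast_eq_zero.mp this
        have : (0 : ℤ) < m * (1 + q) := by positivity
        nlinarith [sq_nonneg ((q : ℤ) - 1)]
    · exact ⟨u, hu, h⟩
  obtain ⟨u, hu, hul⟩ := hroot
  have hu0 : u ≠ 0 := by
    rintro rfl
    exact hqK (by linear_combination hu)
  have hw : u + q ≠ 0 := fun h =>
    mul_ne_zero (mul_ne_zero hmK hq1) hu0
      (by linear_combination hu - (1 + q * u) * h)
  refine ⟨u, -(u + q) / m, hu0, div_ne_zero (neg_ne_zero.mpr hw) hmK, hul, ?_, ?_⟩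
  · field_simp; ring
  · have hmb : m * b = -((1 + q) * a) := by linear_combination hab
    rw [hmb, inv_div, div_neg]
    field_simp
    linear_combination a * hu

lemma sum_mul_comp_fin_three {ι : Type*} [Fintype ι] (g : ι → Fin 3) (f : ι → K) (y : Fin 3 → K) :
    ∑ i, f i * y (g i) = (∑ i with g i = 0, f i) * y 0 + (∑ i with g i = 1, f i) * y 1 +
      (∑ i with g i = 2, f i) * y 2 := by
  rw [← Finset.sum_fiberwise Finset.univ g, Fin.sum_univ_three]
  simp only [Finset.sum_mul]
  congr 1
  · congr 1 <;> exact Finset.sum_congr rfl fun i hi => by rw [(Finset.mem_filter.mp hi).2]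
  · exact Finset.sum_congr rfl fun i hi => by rw [(Finset.mem_filter.mp hi).2]

lemma exists_weights_of_surjective [IsAlgClosed K] [CharZero K] {ι : Type*} [Fintype ι] (d : ι → K)
    (hd : ∑ i, d i = 0) (g : ι → Fin 3) (hg : Function.Surjective g) :
    ∃ y : Fin 3 → K, (∀ t, y t ≠ 0) ∧ ∑ i, y (g i) = 0 ∧ ∑ i, d i * (y (g i))⁻¹ = 0 := by
  have hcard (t : Fin 3) : 0 < (Finset.univ.filter fun i => g i = t).card := by
    obtain ⟨i, hi⟩ := hg t
    exact Finset.card_pos.mpr ⟨i, by simp [hi]⟩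
  have hcast (k : ℕ) (hk : 0 < k) : (k : K) ≠ 0 := Nat.cast_ne_zero.mpr hk.ne'
  have hsum (s t : Fin 3) : ((Finset.univ.filter fun i => g i = s).card : K) +
      (Finset.univ.filter fun i => g i = t).card ≠ 0 := by
    have := hcast _ (Nat.add_pos_left (hcard s) (Finset.univ.filter fun i => g i = t).card)
    push_cast at this
    exact this
  obtain ⟨u, v, w, hu, hv, hw, h₁, h₂⟩ := exists_ne_zero_weights (hcast _ (hcard 0))
    (hcast _ (hcard 1)) (hcast _ (hcard 2)) (hsum 0 1) (hsum 1 2) (hsum 0 2)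
    (show (∑ i with g i = 0, d i) + (∑ i with g i = 1, d i) + (∑ i with g i = 2, d i) = 0 by
      simpa [hd] using (sum_mul_comp_fin_three g d fun _ => 1).symm)
  refine ⟨![u, v, w], by simp [Fin.forall_fin_succ, hu, hv, hw], ?_, ?_⟩
  · simpa [h₁] using sum_mul_comp_fin_three g (fun _ => (1 : K)) ![u, v, w]
  · simpa [h₂] using sum_mul_comp_fin_three g d fun t => (![u, v, w] t)⁻¹

/-- The diagonal entries `x` of an upper triangular factor compatible with the diagonal `d`. -/
def IsAdmissible {n : ℕ} (lam : K) (d x : Fin n → K) : Prop :=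
  (∀ i, x i ≠ 0) ∧ ∑ i, x i = 0 ∧ ∑ i, d i * (x i)⁻¹ = 0 ∧
    ∀ i j, i < j → d i = d j → x i + lam * x j ≠ 0

lemma add_lam_mul_self_ne_zero {lam : K} (hlam : lam ≠ -1) {x : K} (hx : x ≠ 0) :
    x + lam * x ≠ 0 := by
  rw [← one_add_mul]
  exact mul_ne_zero (fun h => hlam (by linear_combination h)) hx

lemma exists_admissible_of_three_values [IsAlgClosed K] [CharZero K] {n : ℕ} {lam : K}
    (hlam : lam ≠ -1) (d : Fin n → K) (hd : ∑ i, d i = 0) {i j k : Fin n} (hij : d i ≠ d j)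
    (hik : d i ≠ d k) (hjk : d j ≠ d k) : ∃ x, IsAdmissible lam d x := by
  classical
  let g : K → Fin 3 := fun c => if c = d i then 0 else if c = d j then 1 else 2
  obtain ⟨y, hy, h₁, h₂⟩ := exists_weights_of_surjective d hd (fun l => g (d l)) (by
    intro t
    fin_cases t
    · exact ⟨i, by simp [g]⟩
    · exact ⟨j, by simp [g, hij.symm]⟩
    · exact ⟨k, by simp [g, hik.symm, hjk.symm]⟩)
  refine ⟨fun l => y (g (d l)), fun l => hy _, h₁, h₂, fun l l' _ h => ?_⟩
  simp only [h]
  exact add_lam_mul_self_ne_zero hlam (hy _)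

lemma exists_admissible_of_two_values [DecidableEq K] [IsAlgClosed K] [CharZero K] {n : ℕ}
    {lam : K}
    (hlam : lam ≠ -1) (d : Fin n → K) (hd : ∑ i, d i = 0) {a b : K} (hab : a ≠ b)
    (h : ∀ i, d i = a ∨ d i = b) (ha : 1 < (Finset.univ.filter fun i => d i = a).card)
    (hb : ∃ j, d j = b) : ∃ x, IsAdmissible lam d x := by
  classical
  obtain ⟨i₀, hi₀, hmin⟩ := (Finset.univ.filter fun i => d i = a).exists_min_image id
    (Finset.card_pos.mp (by omega))
  replace hi₀ : d i₀ = a := by simpa using hi₀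
  obtain ⟨j, hj⟩ := hb
  let g : Fin n → Fin 3 := fun i => if i = i₀ then 0 else if d i = a then 1 else 2
  have hg0 : (Finset.univ.filter fun i => g i = 0) = {i₀} := by
    ext i; simp only [g, Finset.mem_filter, Finset.mem_univ, true_and, Finset.mem_singleton]
    split_ifs <;> simp_all
  have hg1 : (Finset.univ.filter fun i => g i = 1) =
      (Finset.univ.filter fun i => d i = a).erase i₀ := by
    ext i; simp only [g, Finset.mem_filter, Finset.mem_univ, true_and, Finset.mem_erase]
    split_ifs <;> simp_all
  have hg2 : (Finset.univ.filter fun i => g i = 2) = Finset.univ.filter fun i => d i = b := by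
    ext i; simp only [g, Finset.mem_filter, Finset.mem_univ, true_and]
    have := h i
    split_ifs <;> simp_all
  set q := ((Finset.univ.filter fun i => d i = a).erase i₀).card with hqdef
  set m := (Finset.univ.filter fun i => d i = b).card with hmdef
  have hq : q ≠ 0 := by
    rw [hqdef, Finset.card_erase_of_mem (by simp [hi₀])]
    omega
  have hm : m ≠ 0 := (Finset.card_pos.mpr ⟨j, by simp [hj]⟩).ne'
  have hs1 : ∑ i with g i = 1, d i = q * a := by
    rw [hg1, Finset.sum_congr rfl (g := fun _ => a) fun i hi => by simp_all]
    simp [hqdef]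
  have hs2 : ∑ i with g i = 2, d i = m * b := by
    rw [hg2, Finset.sum_congr rfl (g := fun _ => b) fun i hi => by simp_all]
    simp [hmdef]
  have hsum := sum_mul_comp_fin_three g d fun _ => 1
  rw [hs1, hs2, hg0] at hsum
  simp only [mul_one, hd, Finset.sum_singleton, hi₀] at hsum
  obtain ⟨u, w, hu, hw, hul, h₁, h₂⟩ := exists_ne_zero_weights_avoiding hq hm lam
    (a := a) (b := b) (by linear_combination -hsum)
  have hy : ∀ t, ![u, 1, w] t ≠ 0 := by simp [Fin.forall_fin_succ, hu, hw]
  refine ⟨fun i => ![u, 1, w] (g i), fun i => hy _, ?_, ?_, fun i k hik hd' => ?_⟩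
  · have := sum_mul_comp_fin_three g (fun _ => (1 : K)) ![u, 1, w]
    rw [hg0, hg1, hg2] at this
    simp only [one_mul] at this
    rw [this]
    simp [← hqdef, ← hmdef, h₁]
  · have := sum_mul_comp_fin_three g d fun t => (![u, 1, w] t)⁻¹
    rw [hs1, hs2, hg0] at this
    rw [this]
    simp [hi₀, h₂]
  · by_cases hi : i = i₀
    · have hk : k ≠ i₀ := by rintro rfl; exact hik.ne hi
      have hk' : d k = a := by rw [← hd', hi, hi₀]
      simpa [g, hi, hk, hk'] using hul
    · have hk : k ≠ i₀ := by
        rintro rfl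
        exact absurd (hmin i (by simp [hd', hi₀])) (not_le.mpr hik)
      have : g i = g k := by simp [g, hi, hk, hd']
      simp only [this]
      exact add_lam_mul_self_ne_zero hlam (hy _)

lemma exists_admissible_zero [CharZero K] {n : ℕ} (hn : 3 ≤ n) {lam : K} (hlam : lam ≠ -1) :
    ∃ x : Fin n → K, IsAdmissible lam 0 x := by
  obtain ⟨m, rfl⟩ : ∃ m, n = m + 3 := ⟨n - 3, by omega⟩
  have hr : (m + 2 : K) ≠ 0 := by exact_mod_cast (by omega : m + 2 ≠ 0)
  have hsum (k : Fin (m + 3)) : ∑ i, (if i = k then -(m + 2 : K) else 1) = 0 := by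
    rw [← Finset.add_sum_erase _ _ (Finset.mem_univ k), Finset.sum_congr rfl (g := fun _ => (1 : K))
      fun i hi => if_neg (Finset.ne_of_mem_erase hi)]
    simp [Finset.card_erase_of_mem]
  have hne (k i : Fin (m + 3)) : (if i = k then -(m + 2 : K) else 1) ≠ 0 := by
    split_ifs
    exacts [neg_ne_zero.mpr hr, one_ne_zero]
  by_cases h : lam = m + 2
  · refine ⟨_, hne (Fin.last _), hsum _, by simp, fun i j hij _ => ?_⟩
    simp only [(hij.trans_le (Fin.le_last j)).ne, if_false]
    split_ifs
    · have : (((m + 1) * (m + 3) : ℕ) : K) ≠ 0 := Nat.cast_ne_zero.mpr (by positivity)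
      intro h'
      apply this
      push_cast
      linear_combination -h' - (m + 2 : K) * h
    · simpa using add_lam_mul_self_ne_zero hlam one_ne_zero
  · refine ⟨_, hne 0, hsum _, by simp, fun i j hij _ => ?_⟩
    simp only [((Fin.zero_le i).trans_lt hij).ne', if_false]
    split_ifs
    · exact fun h' => h (by linear_combination h')
    · simpa using add_lam_mul_self_ne_zero hlam one_ne_zero

theorem exists_admissible [IsAlgClosed K] [CharZero K] {n : ℕ} (hn : 3 ≤ n) {lam : K}
    (hlam : lam ≠ -1) (d : Fin n → K) (hd : ∑ i, d i = 0) : ∃ x, IsAdmissible lam d x := by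
  classical
  let i₀ : Fin n := ⟨0, by omega⟩
  by_cases h₁ : ∀ i, d i = d i₀
  · have h0 : d = 0 := by
      have hn0 : (n : K) ≠ 0 := Nat.cast_ne_zero.mpr (by omega)
      have : (n : K) * d i₀ = 0 := by simpa [h₁] using hd
      ext i
      rw [h₁ i]
      exact (mul_eq_zero.mp this).resolve_left hn0
    rw [h0]
    exact exists_admissible_zero hn hlam
  push Not at h₁
  obtain ⟨j, hj⟩ := h₁
  by_cases h₂ : ∀ i, d i = d i₀ ∨ d i = d j
  · by_cases hcard : 1 < (Finset.univ.filter fun i => d i = d i₀).card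
    · exact exists_admissible_of_two_values hlam d hd hj.symm h₂ hcard ⟨j, rfl⟩
    · refine exists_admissible_of_two_values hlam d hd hj (fun i => (h₂ i).symm) ?_ ⟨i₀, rfl⟩
      have hle : n ≤ (Finset.univ.filter fun i => d i = d i₀).card +
          (Finset.univ.filter fun i => d i = d j).card := by
        refine le_trans ?_ (Finset.card_union_le _ _)
        rw [← Finset.filter_or, Finset.filter_true_of_mem fun i _ => h₂ i]
        simp
      omega
  · push Not at h₂
    obtain ⟨k, hk, hk'⟩ := h₂
    exact exists_admissible_of_three_values hlam d hd hj.symm hk.symm hk'.symm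

end Weights

theorem stmt_5 (K : Type*) [Field K] [IsAlgClosed K] [CharZero K] (n : ℕ) (hn : 3 ≤ n)
    (lam : K) (hlam : lam ≠ -1)
    (D : Matrix (Fin n) (Fin n) K) (hD : Matrix.trace D = 0) :
    ∃ A B C : Matrix (Fin n) (Fin n) K,
      D = (A * B - B * A) * (A * C - C * A) + lam • ((A * C - C * A) * (A * B - B * A)) := by
  obtain ⟨T, ⟨P, hP⟩, hT, hTd⟩ := exists_isConj_triangular n D
  have hDT : D = P⁻¹.val * T * P.val := by
    rw [mul_assoc, ← hP.eq, ← mul_assoc, Units.inv_mul, one_mul]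
  have htr : T.trace = 0 := by
    rw [← hD, hDT, Matrix.trace_mul_comm, ← mul_assoc, Units.mul_inv, one_mul]
  obtain ⟨x, hx, hx₁, hx₂, hx₃⟩ := exists_admissible hn hlam (fun i => T i i) htr
  let Y : Matrix (Fin n) (Fin n) K := Matrix.of fun i j => T i j * (x i + lam * x j)⁻¹
  obtain ⟨B, hB⟩ := exists_shift_commutator (Matrix.diagonal x)
    (fun i j h => Matrix.diagonal_apply_ne _ h.ne') (by rwa [Matrix.trace_diagonal])
  obtain ⟨C, hC⟩ := exists_shift_commutator Y (fun i j h => by simp [Y, hT i j h]) (by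
    have : ∀ i, Y i i = (1 + lam)⁻¹ * (T i i * (x i)⁻¹) := fun i => by
      simp only [Y, Matrix.of_apply, ← one_add_mul, mul_inv]; ring
    simp only [Matrix.trace, Matrix.diag_apply, this, ← Finset.mul_sum, hx₂, mul_zero])
  have hXY : T = Matrix.diagonal x * Y + lam • (Y * Matrix.diagonal x) := by
    ext i j
    simp only [Matrix.add_apply, Matrix.smul_apply, Matrix.diagonal_mul, Matrix.mul_diagonal,
      smul_eq_mul, Y, Matrix.of_apply]
    by_cases h0 : T i j = 0
    · simp [h0]
    have hne : x i + lam * x j ≠ 0 := by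
      rcases lt_trichotomy i j with hij | rfl | hij
      · exact hx₃ i j hij (hTd i j h0)
      · exact add_lam_mul_self_ne_zero hlam (hx i)
      · exact absurd (hT i j hij) h0
    field_simp
  rw [← hB, ← hC] at hXY
  have hmul (M N : Matrix (Fin n) (Fin n) K) :
      P⁻¹.val * (M * N) * P.val = (P⁻¹.val * M * P.val) * (P⁻¹.val * N * P.val) := by
    simp [mul_assoc]
  refine ⟨P⁻¹.val * shift K n * P.val, P⁻¹.val * B * P.val, P⁻¹.val * C * P.val, ?_⟩
  simp only [← hmul, ← mul_sub, ← sub_mul]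
  rw [← smul_mul_assoc, ← mul_smul_comm, ← add_mul, ← mul_add, hDT, hXY]
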